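/- Let α be a finite type with N elements, let k and n be integers with 1 ≤ k ≤ n ≤ N, and set m = ⌊n/k⌋. Let H be a nonempty class of {0,1}-valued hypotheses f : Finset α → ℝ whose VC dimension (with respect to size-k subsets of α) equals d, where 1 ≤ d ≤ m. If C is a uniformly random size-n subset of α, then for every real ε with 0 < ε ≤ 1: P[ sup_{f ∈ H} | Q_k(Finset.univ, f) − Q_k(C, f) | ≥ ε ] ≤ (1 + √(8 π m) · (2 e m / d)^d) · exp(− m ε² / 8). -/

import Mathlib

open scoped Classical

/-- The average of `f` over all size-`k` subsets of `C`: the probability `Q_{Υ,k}(f)` that a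
uniformly random size-`k` fragment of the relational example with domain `C` satisfies `f`. -/
noncomputable def Qk {α : Type*} [DecidableEq α] (k : ℕ) (C : Finset α) (f : Finset α → ℝ) : ℝ :=
  ((C.card.choose k : ℝ))⁻¹ * ∑ S ∈ C.powersetCard k, f S

/-- `H` shatters the collection `X` of size-`k` subsets of `α`: every `S ∈ X` has cardinality `k`,
and for every `Y ⊆ X` there is `f ∈ H` taking value `1` on `Y` and `0` on `X \ Y`. -/
def Shatters {α : Type*} [DecidableEq α] (k : ℕ)
    (H : Set (Finset α → ℝ)) (X : Finset (Finset α)) : Prop :=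
  (∀ S ∈ X, S.card = k) ∧
    ∀ Y ⊆ X, ∃ f ∈ H, (∀ S ∈ Y, f S = 1) ∧ ∀ S ∈ X \ Y, f S = 0

/-- The VC dimension of `H` with respect to size-`k` subsets of `α` equals `d`: `d` is the largest
cardinality of a collection of size-`k` subsets shattered by `H`. -/
def VCDimEq {α : Type*} [DecidableEq α] (k : ℕ) (H : Set (Finset α → ℝ)) (d : ℕ) : Prop :=
  IsGreatest {m : ℕ | ∃ X : Finset (Finset α), Shatters k H X ∧ X.card = m} d

theorem sum_choose_le_exp_mul_div_pow {d M : ℕ} (hd : 1 ≤ d) (hdM : d ≤ M) :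
    (∑ i ∈ Finset.range (d + 1), (M.choose i : ℝ)) ≤ (Real.exp 1 * M / d) ^ d := by
  have hd0 : (0 : ℝ) < d := by exact_mod_cast hd
  have hM0 : (0 : ℝ) < M := by exact_mod_cast hd.trans hdM
  have hx1 : (d : ℝ) / M ≤ 1 := by
    rw [div_le_one hM0]; exact_mod_cast hdM
  have hx0 : (0 : ℝ) < (d : ℝ) / M := by positivity
  have key : (∑ i ∈ Finset.range (d + 1), (M.choose i : ℝ)) * ((d : ℝ) / M) ^ d ≤
      Real.exp 1 ^ d := by
    calc (∑ i ∈ Finset.range (d + 1), (M.choose i : ℝ)) * ((d : ℝ) / M) ^ d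
        ≤ ∑ i ∈ Finset.range (d + 1), ((d : ℝ) / M) ^ i * (M.choose i : ℝ) := by
          rw [Finset.sum_mul]
          refine Finset.sum_le_sum fun i hi => ?_
          rw [mul_comm]
          gcongr ?_ * _
          exact pow_le_pow_of_le_one hx0.le hx1 (by simpa [Nat.lt_succ_iff] using hi)
      _ ≤ ∑ i ∈ Finset.range (M + 1), ((d : ℝ) / M) ^ i * (M.choose i : ℝ) := by
          refine Finset.sum_le_sum_of_subset_of_nonneg
            (Finset.range_mono (by omega)) fun i _ _ => by positivity
      _ = ((d : ℝ) / M + 1) ^ M := by rw [add_pow]; simp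
      _ ≤ Real.exp ((d : ℝ) / M) ^ M := by gcongr; exact Real.add_one_le_exp _
      _ = Real.exp 1 ^ d := by
          rw [← Real.exp_nat_mul, ← Real.exp_nat_mul]; congr 1; field_simp
  have h2 : (Real.exp 1 * M / d) ^ d * ((d : ℝ) / M) ^ d = Real.exp 1 ^ d := by
    rw [← mul_pow]; congr 1; field_simp
  rw [← h2] at key
  exact le_of_mul_le_mul_right key (by positivity)

/-- Sauer–Shelah for the traces on a finite set `X` of a class of `{0,1}`-valued functions. -/
theorem card_traces_le {β : Type*} [DecidableEq β] (H : Set (β → ℝ)) (X : Finset β) (d : ℕ)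
    (hd : ∀ Y : Finset β, Y ⊆ X →
      (∀ Z ⊆ Y, ∃ f ∈ H, (∀ S ∈ Z, f S = 1) ∧ ∀ S ∈ Y \ Z, f S = 0) → Y.card ≤ d) :
    (X.powerset.filter fun t => ∃ f ∈ H, ∀ S ∈ X, f S = if S ∈ t then 1 else 0).card ≤
      ∑ i ∈ Finset.range (d + 1), X.card.choose i := by
  set A := X.powerset.filter fun t => ∃ f ∈ H, ∀ S ∈ X, f S = if S ∈ t then 1 else 0
  have hsub : A.shatterer ⊆ (Finset.range (d + 1)).biUnion fun i => X.powersetCard i := by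
    intro Y hY
    rw [Finset.mem_shatterer] at hY
    obtain ⟨u, hu, hYu⟩ := hY.exists_superset
    have hYX : Y ⊆ X := hYu.trans (Finset.mem_powerset.1 (Finset.mem_filter.1 hu).1)
    have hc : Y.card ≤ d := by
      refine hd Y hYX fun Z hZ => ?_
      obtain ⟨t, ht, rfl⟩ := hY hZ
      obtain ⟨f, hf, hft⟩ := (Finset.mem_filter.1 ht).2
      refine ⟨f, hf, fun S hS => ?_, fun S hS => ?_⟩
      · rw [Finset.mem_inter] at hS
        rw [hft S (hYX hS.1), if_pos hS.2]
      · simp only [Finset.mem_sdiff, Finset.mem_inter, not_and] at hS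
        rw [hft S (hYX hS.1), if_neg (hS.2 hS.1)]
    simp only [Finset.mem_biUnion, Finset.mem_range, Finset.mem_powersetCard]
    exact ⟨Y.card, by omega, hYX, rfl⟩
  refine A.card_le_card_shatterer.trans ((Finset.card_le_card hsub).trans ?_)
  refine Finset.card_biUnion_le.trans (le_of_eq ?_)
  simp

theorem sum_exp_signs_le {ι : Type*} [Fintype ι] [DecidableEq ι] (a : ι → ℝ) (c : ℝ)
    (ha : ∀ i, a i ^ 2 ≤ c ^ 2) :
    ∑ σ : ι → Bool, Real.exp (∑ i, (if σ i then a i else - a i)) ≤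
      2 ^ Fintype.card ι * Real.exp (Fintype.card ι * c ^ 2 / 2) := by
  have h1 : ∑ σ : ι → Bool, Real.exp (∑ i, (if σ i then a i else - a i)) =
      ∏ i, ∑ b : Bool, Real.exp (if b then a i else - a i) := by
    rw [Finset.prod_univ_sum]
    simp only [Real.exp_sum, Fintype.piFinset_univ]
  rw [h1]
  calc ∏ i, ∑ b : Bool, Real.exp (if b then a i else - a i)
      ≤ ∏ _i : ι, 2 * Real.exp (c ^ 2 / 2) := by
        refine Finset.prod_le_prod (fun i _ => by positivity) fun i _ => ?_
        have h2 := Real.cosh_le_exp_half_sq (a i)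
        have h3 : Real.exp (a i ^ 2 / 2) ≤ Real.exp (c ^ 2 / 2) :=
          Real.exp_le_exp.2 (by linarith [ha i])
        rw [Real.cosh_eq] at h2
        simp
        linarith
    _ = _ := by
        rw [Finset.prod_const, mul_pow, ← Real.exp_nat_mul, Finset.card_univ]
        congr 2
        ring

/-- Symmetrization bound for the exponential moments of the supremum over a class `H` of
`{0,1}`-valued functions of the difference between two empirical averages. -/
theorem sum_exp_iSup_le {K β : Type*} [Fintype K] [DecidableEq β] (v : K → β) {m : ℕ}
    (hm : 0 < m) (H : Set (β → ℝ)) [Finite H] (hH : H.Nonempty)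
    (hbool : ∀ f ∈ H, ∀ S, f S = 0 ∨ f S = 1) (G : ℝ)
    (hG : ∀ X : Finset β, (∀ x ∈ X, ∃ y, v y = x) → X.card ≤ 2 * m →
      ((X.powerset.filter fun t => ∃ f ∈ H, ∀ S ∈ X, f S = if S ∈ t then 1 else 0).card : ℝ) ≤ G)
    {l : ℝ} (hl : 0 ≤ l) :
    ∑ z : Fin m → K × K,
        Real.exp (l * ⨆ f : H, |(m : ℝ)⁻¹ * ∑ i, (f.1 (v (z i).1) - f.1 (v (z i).2))|) ≤
      Fintype.card (Fin m → K × K) * (2 * G * Real.exp (l ^ 2 / (2 * m))) := by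
  have hm0 : (0 : ℝ) < m := by exact_mod_cast hm
  have : Nonempty H := hH.to_subtype
  set F : (Fin m → K × K) → ℝ := fun z =>
    Real.exp (l * ⨆ f : H, |(m : ℝ)⁻¹ * ∑ i, (f.1 (v (z i).1) - f.1 (v (z i).2))|) with hF
  let sw : (Fin m → Bool) → (Fin m → K × K) ≃ (Fin m → K × K) := fun σ =>
    Equiv.piCongrRight fun i => if σ i then Equiv.refl _ else Equiv.prodComm K K
  have hsw : ∀ σ, ∑ z, F (sw σ z) = ∑ z, F z := fun σ => Equiv.sum_comp (sw σ) F
  have hpt : ∀ z, ∑ σ : Fin m → Bool, F (sw σ z) ≤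
      2 ^ m * (2 * G * Real.exp (l ^ 2 / (2 * m))) := by
    intro z
    set X : Finset β := Finset.univ.image (fun i => v (z i).1) ∪
      Finset.univ.image (fun i => v (z i).2) with hX
    set A := X.powerset.filter fun t => ∃ f ∈ H, ∀ S ∈ X, f S = if S ∈ t then 1 else 0 with hA
    have hAG : (A.card : ℝ) ≤ G := by
      refine hG X ?_ ?_
      · intro x hx
        simp only [hX, Finset.mem_union, Finset.mem_image] at hx
        rcases hx with ⟨i, -, h⟩ | ⟨i, -, h⟩
        · exact ⟨_, h⟩
        · exact ⟨_, h⟩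
      · refine (Finset.card_union_le _ _).trans ?_
        have h1 := Finset.card_image_le (s := Finset.univ) (f := fun i : Fin m => v (z i).1)
        have h2 := Finset.card_image_le (s := Finset.univ) (f := fun i : Fin m => v (z i).2)
        simp only [Finset.card_univ, Fintype.card_fin] at h1 h2
        omega
    let a : Finset β → Fin m → ℝ := fun t i =>
      l / m * ((if v (z i).1 ∈ t then 1 else 0) - (if v (z i).2 ∈ t then 1 else 0))
    have ha : ∀ t i, a t i ^ 2 ≤ (l / m) ^ 2 := by
      intro t i
      have : 0 ≤ (l / m) ^ 2 := sq_nonneg _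
      simp only [a]
      split_ifs <;> simp [this]
    have hb : ∀ σ, F (sw σ z) ≤ ∑ t ∈ A,
        (Real.exp (∑ i, if σ i then a t i else - a t i) +
          Real.exp (∑ i, if σ i then - a t i else - - a t i)) := by
      intro σ
      obtain ⟨f, hf⟩ := exists_eq_ciSup_of_finite (f := fun f : H =>
        |(m : ℝ)⁻¹ * ∑ i, (f.1 (v (sw σ z i).1) - f.1 (v (sw σ z i).2))|)
      have htr : ∀ S ∈ X, f.1 S = if S ∈ X.filter (fun S => f.1 S = 1) then 1 else 0 := by
        intro S hS
        rcases hbool f.1 f.2 S with h | h <;> simp [h, hS]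
      have htA : X.filter (fun S => f.1 S = 1) ∈ A := by
        rw [hA, Finset.mem_filter, Finset.mem_powerset]
        exact ⟨Finset.filter_subset _ _, f.1, f.2, htr⟩
      set t := X.filter (fun S => f.1 S = 1)
      have hsum : l * ((m : ℝ)⁻¹ * ∑ i, (f.1 (v (sw σ z i).1) - f.1 (v (sw σ z i).2))) =
          ∑ i, if σ i then a t i else - a t i := by
        rw [← mul_assoc, Finset.mul_sum]
        refine Finset.sum_congr rfl fun i _ => ?_
        have h1 := htr (v (z i).1) (by simp [hX])
        have h2 := htr (v (z i).2) (by simp [hX])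
        simp only [a, ← h1, ← h2, sw, Equiv.piCongrRight_apply, Pi.map_apply]
        split_ifs
        · simp [div_eq_mul_inv]
        · simp [div_eq_mul_inv]; ring
      have hneg : (∑ i, if σ i then - a t i else - - a t i) =
          - ∑ i, if σ i then a t i else - a t i := by
        rw [← Finset.sum_neg_distrib]
        exact Finset.sum_congr rfl fun i _ => by split_ifs <;> rfl
      refine le_trans ?_ (Finset.single_le_sum (fun t _ => by positivity) htA)
      simp only [hF]
      have habs : ∀ x : ℝ, l * |x| = |l * x| := fun x => by rw [abs_mul, abs_of_nonneg hl]
      rw [← hf, habs, hsum, hneg]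
      exact Real.exp_abs_le _
    calc ∑ σ, F (sw σ z) ≤ ∑ σ, ∑ t ∈ A,
        (Real.exp (∑ i, if σ i then a t i else - a t i) +
          Real.exp (∑ i, if σ i then - a t i else - - a t i)) :=
          Finset.sum_le_sum fun σ _ => hb σ
      _ = ∑ t ∈ A, (∑ σ : Fin m → Bool, Real.exp (∑ i, if σ i then a t i else - a t i) +
          ∑ σ : Fin m → Bool, Real.exp (∑ i, if σ i then - a t i else - - a t i)) := by
          rw [Finset.sum_comm]
          simp only [Finset.sum_add_distrib]
      _ ≤ ∑ t ∈ A, (2 ^ m * Real.exp (l ^ 2 / (2 * m)) + 2 ^ m * Real.exp (l ^ 2 / (2 * m))) := by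
          have he : (m : ℝ) * (l / m) ^ 2 / 2 = l ^ 2 / (2 * m) := by field_simp
          refine Finset.sum_le_sum fun t _ => add_le_add ?_ ?_
          · simpa [he] using sum_exp_signs_le (a t) (l / m) (ha t)
          · simpa [he] using sum_exp_signs_le (fun i => - a t i) (l / m)
              (fun i => by simpa using ha t i)
      _ = A.card * (2 ^ m * (2 * Real.exp (l ^ 2 / (2 * m)))) := by
          rw [Finset.sum_const, nsmul_eq_mul]; ring
      _ ≤ G * (2 ^ m * (2 * Real.exp (l ^ 2 / (2 * m)))) := by gcongr
      _ = _ := by ring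
  have htot : (2 : ℝ) ^ m * ∑ z, F z ≤
      2 ^ m * (Fintype.card (Fin m → K × K) * (2 * G * Real.exp (l ^ 2 / (2 * m)))) := by
    calc (2 : ℝ) ^ m * ∑ z, F z = ∑ σ : Fin m → Bool, ∑ z, F (sw σ z) := by
          simp only [hsw, Finset.sum_const, nsmul_eq_mul]
          simp
      _ = ∑ z, ∑ σ : Fin m → Bool, F (sw σ z) := Finset.sum_comm
      _ ≤ ∑ _z : Fin m → K × K, 2 ^ m * (2 * G * Real.exp (l ^ 2 / (2 * m))) :=
          Finset.sum_le_sum fun z _ => hpt z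
      _ = _ := by rw [Finset.sum_const, nsmul_eq_mul, Finset.card_univ]; ring
  exact le_of_mul_le_mul_left htot (by positivity)

theorem exists_perm_map_eq {α : Type*} [Fintype α] [DecidableEq α] {S S' C C' : Finset α}
    (hS : S ⊆ C) (hS' : S' ⊆ C') (h : S.card = S'.card) (hC : C.card = C'.card) :
    ∃ π : Equiv.Perm α, S.map π.toEmbedding = S' ∧ C.map π.toEmbedding = C' := by
  have key : ∀ p q : Bool,
      (Finset.univ.filter fun a => (decide (a ∈ S), decide (a ∈ C)) = (p, q)).card =
      (Finset.univ.filter fun a => (decide (a ∈ S'), decide (a ∈ C')) = (p, q)).card := by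
    have h1 : ∀ {T D : Finset α}, T ⊆ D →
        (Finset.univ.filter fun a => (decide (a ∈ T), decide (a ∈ D)) = (true, true)) = T ∧
        (Finset.univ.filter fun a => (decide (a ∈ T), decide (a ∈ D)) = (true, false)) = ∅ ∧
        (Finset.univ.filter fun a => (decide (a ∈ T), decide (a ∈ D)) = (false, true)) = D \ T ∧
        (Finset.univ.filter fun a => (decide (a ∈ T), decide (a ∈ D)) = (false, false)) = Dᶜ := by
      intro T D hTD
      refine ⟨?_, ?_, ?_, ?_⟩ <;> ext a <;> have := @hTD a <;> simp <;> tauto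
    obtain ⟨a1, a2, a3, a4⟩ := h1 hS
    obtain ⟨b1, b2, b3, b4⟩ := h1 hS'
    rintro (_ | _) (_ | _)
    · rw [a4, b4, Finset.card_compl, Finset.card_compl, hC]
    · rw [a3, b3, Finset.card_sdiff_of_subset hS, Finset.card_sdiff_of_subset hS', h, hC]
    · rw [a2, b2]
    · rw [a1, b1, h]
  have e : ∀ c : Bool × Bool, Nonempty
      ({a // (decide (a ∈ S), decide (a ∈ C)) = c} ≃
        {a // (decide (a ∈ S'), decide (a ∈ C')) = c}) := fun c => by
    refine Fintype.card_eq.1 ?_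
    rw [Fintype.card_subtype, Fintype.card_subtype]
    exact key c.1 c.2
  let π : Equiv.Perm α := Equiv.ofFiberEquiv fun c => (e c).some
  have hπ : ∀ a, (π a ∈ S' ↔ a ∈ S) ∧ (π a ∈ C' ↔ a ∈ C) := fun a => by
    have h' : (decide (π a ∈ S'), decide (π a ∈ C')) = (decide (a ∈ S), decide (a ∈ C)) :=
      Equiv.ofFiberEquiv_map (fun c => (e c).some) a
    simpa only [Prod.mk.injEq, decide_eq_decide] using h'
  refine ⟨π, ?_, ?_⟩
  · ext b
    rw [Finset.mem_map_equiv, ← (hπ _).1, Equiv.apply_symm_apply]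
  · ext b
    rw [Finset.mem_map_equiv, ← (hπ _).2, Equiv.apply_symm_apply]

/-- Coupling of `m` independent uniform size-`k` subsets of `α` with a uniform size-`n` subset `C`:
`p C` is the conditional distribution of the subsets given `C`. -/
theorem exists_coupling {α : Type*} [Fintype α] [DecidableEq α] {k n m : ℕ}
    (hmk : m * k ≤ n) (hkn : k ≤ n) (hn : n ≤ Fintype.card α) :
    ∃ p : Finset α → (Fin m → (Finset.univ : Finset α).powersetCard k) → ℝ,
      (∀ C s, 0 ≤ p C s) ∧
      (∀ s, ∑ C ∈ (Finset.univ : Finset α).powersetCard n, p C s =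
        ((Fintype.card α).choose n : ℝ) /
          Fintype.card (Fin m → (Finset.univ : Finset α).powersetCard k)) ∧
      ∀ C ∈ (Finset.univ : Finset α).powersetCard n,
        ∀ i f, ∑ s, p C s * f (s i).1 = Qk k C f := by
  set K := (Finset.univ : Finset α).powersetCard k with hK
  set P := (Finset.univ : Finset α).powersetCard n with hP
  have hPk : ∀ {C}, C ∈ P ↔ C.card = n := by simp [hP]
  have hKk : ∀ {S}, S ∈ K ↔ S.card = k := by simp [hK]
  let E : (Fin m → K) → Finset (Finset α) := fun s => P.filter fun C => ∀ i, (s i).1 ⊆ C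
  have hE : ∀ s, (E s).Nonempty := by
    intro s
    have hU : (Finset.univ.biUnion fun i => (s i).1).card ≤ n := by
      refine (Finset.card_biUnion_le_card_mul _ _ k fun i _ => ?_).trans (by simpa using hmk)
      exact (hKk.1 (s i).2).le
    obtain ⟨C, hC, -, hCn⟩ := Finset.exists_subsuperset_card_eq
      (Finset.subset_univ (Finset.univ.biUnion fun i => (s i).1)) hU (by simpa using hn)
    refine ⟨C, Finset.mem_filter.2 ⟨hPk.2 hCn, fun i => ?_⟩⟩
    exact (Finset.subset_biUnion_of_mem (fun i => (s i).1) (Finset.mem_univ i)).trans hC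
  let a : Finset α → (Fin m → K) → ℝ := fun C s => if C ∈ E s then ((E s).card : ℝ)⁻¹ else 0
  have ha0 : ∀ C s, 0 ≤ a C s := fun C s => by simp only [a]; split_ifs <;> positivity
  have ha1 : ∀ s, ∑ C ∈ P, a C s = 1 := by
    intro s
    have : ((E s).card : ℝ) ≠ 0 := by exact_mod_cast (hE s).card_pos.ne'
    simp only [a]
    rw [← Finset.sum_filter, Finset.filter_mem_eq_inter,
      Finset.inter_eq_right.2 (Finset.filter_subset _ _), Finset.sum_const, nsmul_eq_mul,
      mul_inv_cancel₀ this]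
  let act : Equiv.Perm α → (Fin m → K) ≃ (Fin m → K) := fun π =>
    Equiv.piCongrRight fun _ => (Equiv.finsetCongr π).subtypeEquiv fun S => by
      simp [hKk]
  have hact : ∀ π s i, (act π s i).1 = (s i).1.map π.toEmbedding := fun π s i => rfl
  have hEact : ∀ π s C, C.map π.toEmbedding ∈ E (act π s) ↔ C ∈ E s := by
    intro π s C
    simp only [E, Finset.mem_filter, hPk, hact, Finset.card_map, Finset.map_subset_map]
  have hEcard : ∀ π s, (E (act π s)).card = (E s).card := by
    intro π s
    refine (Finset.card_equiv (Equiv.finsetCongr π) fun C => ?_).symm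
    simpa using (hEact π s C).symm
  have haact : ∀ π s C, a (C.map π.toEmbedding) (act π s) = a C s := by
    intro π s C
    simp only [a, hEact, hEcard]
  let W : Fin m → K → Finset α → ℝ := fun i S C => ∑ s, if s i = S then a C s else 0
  have hW0 : ∀ i (S : K) C, ¬ S.1 ⊆ C → W i S C = 0 := by
    intro i S C hSC
    refine Finset.sum_eq_zero fun s _ => ?_
    split_ifs with h
    · refine if_neg fun hC => hSC ?_
      rw [← h]
      exact (Finset.mem_filter.1 hC).2 i
    · rfl
  have hWeq : ∀ i (S S' : K), ∀ C ∈ P, ∀ C' ∈ P, S.1 ⊆ C → S'.1 ⊆ C' → W i S C = W i S' C' := by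
    intro i S S' C hC C' hC' hSC hSC'
    obtain ⟨π, h1, h2⟩ := exists_perm_map_eq hSC hSC' ((hKk.1 S.2).trans (hKk.1 S'.2).symm)
      ((hPk.1 hC).trans (hPk.1 hC').symm)
    simp only [W]
    rw [← Equiv.sum_comp (act π) fun s => if s i = S' then a C' s else 0]
    refine Finset.sum_congr rfl fun s _ => ?_
    have : act π s i = S' ↔ s i = S := by
      rw [Subtype.ext_iff, Subtype.ext_iff, hact, ← h1, Finset.map_inj]
    simp only [this, ← h2, haact]
  have hfub : ∀ i C (f : Finset α → ℝ), ∑ s, a C s * f (s i).1 = ∑ S : K, W i S C * f S.1 := by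
    intro i C f
    simp only [W, Finset.sum_mul]
    rw [Finset.sum_comm]
    refine Finset.sum_congr rfl fun s _ => ?_
    simp [ite_mul]
  obtain ⟨C₀, -, hC₀⟩ := Finset.exists_subset_card_eq
    (s := (Finset.univ : Finset α)) (n := n) (by simpa using hn)
  obtain ⟨S₀, hS₀C, hS₀⟩ := Finset.exists_subset_card_eq (s := C₀) (n := k) (by omega)
  have hsum : ∀ i, ∀ C ∈ P, ∀ f : Finset α → ℝ, ∑ s, a C s * f (s i).1 =
      W i ⟨S₀, hKk.2 hS₀⟩ C₀ * ∑ S ∈ C.powersetCard k, f S := by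
    intro i C hC f
    have hsub : C.powersetCard k = K.filter (· ⊆ C) := by
      ext S
      simp [hKk, Finset.mem_powersetCard, and_comm]
    rw [hfub, hsub, Finset.sum_filter, Finset.mul_sum,
      ← Finset.sum_coe_sort K fun S => W i ⟨S₀, hKk.2 hS₀⟩ C₀ * if S ⊆ C then f S else 0]
    refine Finset.sum_congr rfl fun S _ => ?_
    split_ifs with h
    · rw [hWeq i S ⟨S₀, hKk.2 hS₀⟩ C hC C₀ (hPk.2 hC₀) h hS₀C]
    · rw [hW0 i S C h]; simp
  have hcn : (0 : ℝ) < n.choose k := by exact_mod_cast Nat.choose_pos hkn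
  have hcN : (0 : ℝ) < (Fintype.card α).choose n := by exact_mod_cast Nat.choose_pos hn
  have : Nonempty (Fin m → K) := ⟨fun _ => ⟨S₀, hKk.2 hS₀⟩⟩
  have hcΩ : (0 : ℝ) < Fintype.card (Fin m → K) := by exact_mod_cast Fintype.card_pos
  have hc : ∀ i, (Fintype.card (Fin m → K) : ℝ) =
      (Fintype.card α).choose n * (W i ⟨S₀, hKk.2 hS₀⟩ C₀ * n.choose k) := by
    intro i
    calc (Fintype.card (Fin m → K) : ℝ) = ∑ s : Fin m → K, ∑ C ∈ P, a C s := by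
          simp only [ha1, Finset.sum_const, Finset.card_univ, nsmul_eq_mul, mul_one]
      _ = ∑ C ∈ P, ∑ s, a C s * (fun _ : Finset α => (1 : ℝ)) (s i).1 := by
          rw [Finset.sum_comm]; simp
      _ = ∑ C ∈ P, W i ⟨S₀, hKk.2 hS₀⟩ C₀ * n.choose k := by
          refine Finset.sum_congr rfl fun C hC => ?_
          refine (hsum i C hC fun _ => 1).trans ?_
          simp [hPk.1 hC]
      _ = _ := by
          rw [Finset.sum_const, nsmul_eq_mul, hP, Finset.card_powersetCard, Finset.card_univ]
  refine ⟨fun C s => ((Fintype.card α).choose n : ℝ) / Fintype.card (Fin m → K) * a C s,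
    fun C s => mul_nonneg (by positivity) (ha0 C s), fun s => ?_, fun C hC i f => ?_⟩
  · rw [← Finset.mul_sum, ha1, mul_one]
  · simp only [mul_assoc]
    rw [← Finset.mul_sum, hsum i C hC, Qk, hPk.1 hC]
    have h := hc i
    have hw : W i ⟨S₀, hKk.2 hS₀⟩ C₀ ≠ 0 := by
      intro h0
      rw [h0] at h
      simp only [zero_mul, mul_zero] at h
      exact hcΩ.ne' h
    rw [h]
    field_simp

theorem finite_of_forall_eq_zero_or_one {β : Type*} [Finite β] (H : Set (β → ℝ))
    (hbool : ∀ f ∈ H, ∀ S, f S = 0 ∨ f S = 1) : H.Finite :=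
  (Set.Finite.pi' fun _ : β => Set.toFinite ({0, 1} : Set ℝ)).subset fun f hf S => by
    simpa using hbool f hf S

/-- The exponential moment of the deviation under sampling without replacement is at most that of
the difference of two empirical averages over `m` independent uniform size-`k` subsets. -/
theorem sum_exp_iSup_Qk_le {α : Type*} [Fintype α] [DecidableEq α] {k n m : ℕ} (hm : 0 < m)
    (hmk : m * k ≤ n) (hkn : k ≤ n) (hn : n ≤ Fintype.card α) (H : Set (Finset α → ℝ)) [Finite H]
    (hH : H.Nonempty) {l : ℝ} (hl : 0 ≤ l) :
    ∑ C ∈ (Finset.univ : Finset α).powersetCard n,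
        Real.exp (l * ⨆ f : H, |Qk k Finset.univ f.1 - Qk k C f.1|) ≤
      ((Fintype.card α).choose n : ℝ) *
        ((Fintype.card (Fin m → (Finset.univ : Finset α).powersetCard k ×
            (Finset.univ : Finset α).powersetCard k) : ℝ)⁻¹ *
          ∑ z : Fin m → (Finset.univ : Finset α).powersetCard k ×
              (Finset.univ : Finset α).powersetCard k,
            Real.exp (l * ⨆ f : H, |(m : ℝ)⁻¹ * ∑ i, (f.1 (z i).1.1 - f.1 (z i).2.1)|)) := by
  have : Nonempty H := hH.to_subtype
  have hm0 : (m : ℝ) ≠ 0 := by exact_mod_cast hm.ne'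
  have hp := exists_coupling hmk hkn hn
  have hq := exists_coupling (hmk.trans hn) (hkn.trans hn)
    (le_refl (Fintype.card α))
  set K := (Finset.univ : Finset α).powersetCard k
  set P := (Finset.univ : Finset α).powersetCard n with hP
  set c : ℝ := ((Fintype.card (Fin m → K) : ℕ) : ℝ)
  obtain ⟨p, hp0, hpC, hpQ⟩ := hp
  obtain ⟨q, -, hqC, hqQ⟩ := hq
  have hun : (Finset.univ : Finset α).powersetCard (Fintype.card α) = {Finset.univ} := by
    rw [← Finset.card_univ, Finset.powersetCard_self]
  have hq : ∀ s, q Finset.univ s = c⁻¹ := by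
    intro s
    have h := hqC s
    rw [hun, Finset.sum_singleton] at h
    rw [h]; simp
  have hqQ' : ∀ i f, ∑ s : Fin m → K, c⁻¹ * f (s i).1 = Qk k Finset.univ f := by
    intro i f
    rw [← hqQ Finset.univ (by simp [hun]) i f]
    simp only [hq]
  have hQ1 : ∀ C : Finset α, k ≤ C.card → Qk k C (fun _ => 1) = 1 := by
    intro C hC
    have : (C.card.choose k : ℝ) ≠ 0 := by exact_mod_cast (Nat.choose_pos hC).ne'
    simp [Qk, this]
  have hc1 : ∑ _s : Fin m → K, c⁻¹ = 1 := by
    have h := hqQ' ⟨0, hm⟩ fun _ => 1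
    rw [hQ1 _ (by simpa using hkn.trans hn)] at h
    simpa only [mul_one] using h
  let D : (Finset α → ℝ) → (Fin m → K) × (Fin m → K) → ℝ := fun f x =>
    (m : ℝ)⁻¹ * ∑ i, (f (x.1 i).1 - f (x.2 i).1)
  let Z : (Fin m → K) × (Fin m → K) → ℝ := fun x => ⨆ f : H, |D f.1 x|
  have hjensen : ∀ C ∈ P, Real.exp (l * ⨆ f : H, |Qk k Finset.univ f.1 - Qk k C f.1|) ≤
      ∑ x : (Fin m → K) × (Fin m → K), p C x.1 * c⁻¹ * Real.exp (l * Z x) := by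
    intro C hC
    have hCn : C.card = n := by simpa [hP] using hC
    have hp1 : ∑ s, p C s = 1 := by
      have h := hpQ C hC ⟨0, hm⟩ fun _ => 1
      rw [hQ1 _ (hkn.trans hCn.ge)] at h
      simpa only [mul_one] using h
    have hw0 : ∀ x : (Fin m → K) × (Fin m → K), 0 ≤ p C x.1 * c⁻¹ := fun x =>
      mul_nonneg (hp0 _ _) (by positivity)
    have hw1 : ∑ x : (Fin m → K) × (Fin m → K), p C x.1 * c⁻¹ = 1 := by
      rw [Fintype.sum_prod_type]
      simp only [← Finset.mul_sum, hc1, mul_one, hp1]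
    have hD : ∀ f, ∑ x : (Fin m → K) × (Fin m → K), p C x.1 * c⁻¹ * D f x =
        Qk k C f - Qk k Finset.univ f := by
      intro f
      have h1 : ∀ i, ∑ x : (Fin m → K) × (Fin m → K),
          p C x.1 * c⁻¹ * (f (x.1 i).1 - f (x.2 i).1) = Qk k C f - Qk k Finset.univ f := by
        intro i
        simp only [mul_sub, Finset.sum_sub_distrib]
        congr 1
        · rw [Fintype.sum_prod_type, ← hpQ C hC i f]
          refine Finset.sum_congr rfl fun s _ => ?_
          dsimp only
          rw [← Finset.sum_mul, ← Finset.mul_sum, hc1, mul_one]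
        · rw [Fintype.sum_prod_type]
          simp only [mul_assoc, ← Finset.mul_sum, hqQ']
          rw [← Finset.sum_mul, hp1, one_mul]
      calc ∑ x : (Fin m → K) × (Fin m → K), p C x.1 * c⁻¹ * D f x
          = (m : ℝ)⁻¹ * ∑ i, ∑ x : (Fin m → K) × (Fin m → K),
              p C x.1 * c⁻¹ * (f (x.1 i).1 - f (x.2 i).1) := by
            rw [Finset.sum_comm, Finset.mul_sum]
            refine Finset.sum_congr rfl fun x _ => ?_
            rw [← Finset.mul_sum]
            simp only [D]
            ring
        _ = _ := by
            simp only [h1, Finset.sum_const, Finset.card_univ, Fintype.card_fin, nsmul_eq_mul]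
            field_simp
    have hsup : (⨆ f : H, |Qk k Finset.univ f.1 - Qk k C f.1|) ≤
        ∑ x : (Fin m → K) × (Fin m → K), p C x.1 * c⁻¹ * Z x := by
      refine ciSup_le fun f => ?_
      rw [abs_sub_comm, ← hD]
      refine (Finset.abs_sum_le_sum_abs _ _).trans (Finset.sum_le_sum fun x _ => ?_)
      rw [abs_mul, abs_of_nonneg (hw0 x)]
      exact mul_le_mul_of_nonneg_left (Finite.le_ciSup (fun f : H => |D f.1 x|) f) (hw0 x)
    calc Real.exp (l * ⨆ f : H, |Qk k Finset.univ f.1 - Qk k C f.1|)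
        ≤ Real.exp (∑ x : (Fin m → K) × (Fin m → K), (p C x.1 * c⁻¹) • (l * Z x)) := by
          refine Real.exp_le_exp.2 ((mul_le_mul_of_nonneg_left hsup hl).trans (le_of_eq ?_))
          rw [Finset.mul_sum]
          exact Finset.sum_congr rfl fun x _ => by rw [smul_eq_mul]; ring
      _ ≤ ∑ x : (Fin m → K) × (Fin m → K), (p C x.1 * c⁻¹) • Real.exp (l * Z x) :=
          convexOn_exp.map_sum_le (fun x _ => hw0 x) hw1 fun x _ => Set.mem_univ _
  refine (Finset.sum_le_sum hjensen).trans (le_of_eq ?_)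
  rw [Finset.sum_comm]
  calc ∑ x : (Fin m → K) × (Fin m → K), ∑ C ∈ P, p C x.1 * c⁻¹ * Real.exp (l * Z x)
      = ∑ x : (Fin m → K) × (Fin m → K),
          (Fintype.card α).choose n * (c * c)⁻¹ * Real.exp (l * Z x) := by
        refine Finset.sum_congr rfl fun x _ => ?_
        rw [← Finset.sum_mul, ← Finset.sum_mul, hpC, mul_inv, div_eq_mul_inv]
        ring
    _ = (Fintype.card α).choose n * ((c * c)⁻¹ * ∑ x, Real.exp (l * Z x)) := by
        rw [← Finset.mul_sum, mul_assoc]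
    _ = _ := by
        congr 2
        · rw [Fintype.card_congr (Equiv.arrowProdEquivProdArrow (Fin m) (fun _ => K) fun _ => K),
            Fintype.card_prod, Nat.cast_mul]
        · exact (Equiv.sum_comp
            (Equiv.arrowProdEquivProdArrow (Fin m) (fun _ => K) fun _ => K) _).symm

/-- Simplified (looser) tail bound from the paper for `sup_{f ∈ H} |Q_k(univ, f) − Q_k(C, f)|` where `C` is a
uniformly random size-`n` subset of `α`, in terms of the VC dimension `d` of `H` and `m = ⌊n/k⌋`. -/
theorem stmt2 {α : Type*} [Fintype α] [DecidableEq α] (N k n d : ℕ)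
    (hN : Fintype.card α = N) (hk : 1 ≤ k) (hkn : k ≤ n) (hnN : n ≤ N)
    (H : Set (Finset α → ℝ)) (hH : H.Nonempty)
    (hbool : ∀ f ∈ H, ∀ S : Finset α, f S = 0 ∨ f S = 1)
    (hd : 1 ≤ d) (hdm : d ≤ n / k)
    (hVC : VCDimEq k H d) (ε : ℝ) (hε0 : 0 < ε) (hε1 : ε ≤ 1) :
    (N.choose n : ℝ)⁻¹ *
        (((Finset.univ : Finset α).powersetCard n).filter
            (fun C => ε ≤ ⨆ f : H, |Qk k Finset.univ f.1 - Qk k C f.1|)).card ≤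
      (1 + Real.sqrt (8 * Real.pi * (n / k : ℕ)) *
            (2 * Real.exp 1 * (n / k : ℕ) / d) ^ d) *
          Real.exp (-((n / k : ℕ) * ε ^ 2) / 8) := by
  subst hN
  set m := n / k with hmdef
  have hm : 0 < m := Nat.div_pos hkn hk
  have hm0 : (0 : ℝ) < m := by exact_mod_cast hm
  have hm1 : (1 : ℝ) ≤ m := by exact_mod_cast hm
  have hd0 : (0 : ℝ) < d := by exact_mod_cast hd
  have : Finite H := (finite_of_forall_eq_zero_or_one H hbool).to_subtype
  have hc : (0 : ℝ) < (Fintype.card α).choose n := by exact_mod_cast Nat.choose_pos hnN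
  set G : ℝ := (2 * Real.exp 1 * m / d) ^ d with hGdef
  have hG0 : 0 < G := by positivity
  have hG : ∀ X : Finset (Finset α),
      (∀ x ∈ X, ∃ y : (Finset.univ : Finset α).powersetCard k, y.1 = x) → X.card ≤ 2 * m →
      ((X.powerset.filter fun t => ∃ f ∈ H, ∀ S ∈ X, f S = if S ∈ t then 1 else 0).card : ℝ) ≤
        G := by
    intro X hX hXm
    have h1 := card_traces_le H X d fun Y hY hsh => hVC.2 ⟨Y, ⟨fun S hS => by
      obtain ⟨y, rfl⟩ := hX S (hY hS)
      exact (Finset.mem_powersetCard.1 y.2).2, hsh⟩, rfl⟩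
    have h2 : (∑ i ∈ Finset.range (d + 1), X.card.choose i) ≤
        ∑ i ∈ Finset.range (d + 1), (2 * m).choose i :=
      Finset.sum_le_sum fun i _ => Nat.choose_le_choose i hXm
    have h3 : ((∑ i ∈ Finset.range (d + 1), (2 * m).choose i : ℕ) : ℝ) ≤ G := by
      have h := sum_choose_le_exp_mul_div_pow hd (by omega : d ≤ 2 * m)
      push_cast at h ⊢
      refine h.trans (le_of_eq ?_)
      rw [hGdef]
      ring
    exact le_trans (by exact_mod_cast h1.trans h2) h3
  have hmom : ∑ C ∈ (Finset.univ : Finset α).powersetCard n,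
      Real.exp (m * ε * ⨆ f : H, |Qk k Finset.univ f.1 - Qk k C f.1|) ≤
        (Fintype.card α).choose n * (2 * G * Real.exp ((m * ε) ^ 2 / (2 * m))) := by
    refine (sum_exp_iSup_Qk_le hm (Nat.div_mul_le_self n k) hkn hnN H hH
      (by positivity : (0 : ℝ) ≤ m * ε)).trans ?_
    refine mul_le_mul_of_nonneg_left ?_ hc.le
    refine inv_mul_le_of_le_mul₀ (by positivity) (by positivity) ?_
    exact sum_exp_iSup_le Subtype.val hm H hH hbool G hG (by positivity)
  have hmarkov : ((((Finset.univ : Finset α).powersetCard n).filter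
      (fun C => ε ≤ ⨆ f : H, |Qk k Finset.univ f.1 - Qk k C f.1|)).card : ℝ) *
        Real.exp (m * ε * ε) ≤
      (Fintype.card α).choose n * (2 * G * Real.exp ((m * ε) ^ 2 / (2 * m))) := by
    refine le_trans ?_ hmom
    rw [← nsmul_eq_mul]
    refine le_trans (Finset.card_nsmul_le_sum _
      (fun C => Real.exp (m * ε * ⨆ f : H, |Qk k Finset.univ f.1 - Qk k C f.1|)) _ ?_)
      (Finset.sum_le_sum_of_subset_of_nonneg (Finset.filter_subset _ _)
        fun C _ _ => by positivity)
    intro C hC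
    exact Real.exp_le_exp.2 (mul_le_mul_of_nonneg_left (Finset.mem_filter.1 hC).2 (by positivity))
  have hsqrt : (2 : ℝ) ≤ Real.sqrt (8 * Real.pi * m) := by
    refine Real.le_sqrt_of_sq_le ?_
    nlinarith [Real.pi_gt_three]
  have hexp : Real.exp ((m * ε) ^ 2 / (2 * m)) ≤
      Real.exp (-(m * ε ^ 2) / 8) * Real.exp (m * ε * ε) := by
    rw [← Real.exp_add]
    refine Real.exp_le_exp.2 ?_
    have : (m * ε) ^ 2 / (2 * m) = m * ε ^ 2 / 2 := by field_simp
    rw [this]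
    nlinarith [mul_pos hm0 (pow_pos hε0 2)]
  refine inv_mul_le_of_le_mul₀ hc.le (by positivity) ?_
  refine le_of_mul_le_mul_right (hmarkov.trans ?_) (Real.exp_pos (m * ε * ε))
  rw [mul_assoc (Nat.cast _ : ℝ), mul_assoc (1 + _)]
  refine mul_le_mul_of_nonneg_left ?_ hc.le
  refine mul_le_mul ?_ hexp (by positivity) (by positivity)
  nlinarith [mul_le_mul_of_nonneg_right hsqrt hG0.le]
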